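/- arXiv:1508.01544 — 3 statements merged into one kernel-verified Lean document; each statement's English description precedes it below -/
import Mathlib

section
/- Let A and B be Hermitian n×n complex matrices and M ≥ 0 a real number such that for every vector x ∈ ℂⁿ, 0 ≤ Re(⟨x, B x⟩) and Re(⟨x, B x⟩) ≤ M·‖x‖². Suppose λ₀ < λ₁ < ... < λⱼ are real eigenvalues of A satisfying λₙ − λₙ₋₁ > M for n = 1, ..., j. Then there exist real numbers μ₀ < μ₁ < ... < μⱼ, each an eigenvalue of A + B, such that λₙ ≤ μₙ ≤ λₙ + M for every n; in particular A + B has at least j + 1 distinct eigenvalues in the interval [λ₀, λⱼ + M]. -/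
open Matrix

/-- Expansion of `⟪(T - a) v, (T - b) v⟫` in an eigenbasis of the symmetric operator `T`. -/
lemma LinearMap.IsSymmetric.inner_sub_smul_sub_smul {E : Type*} [NormedAddCommGroup E]
    [InnerProductSpace ℂ E] [FiniteDimensional ℂ E] {T : E →ₗ[ℂ] E} (hT : T.IsSymmetric)
    {n : ℕ} (hn : Module.finrank ℂ E = n) (a b : ℝ) (v : E) :
    (inner ℂ (T v - (a : ℂ) • v) (T v - (b : ℂ) • v)).re =
      ∑ i, (hT.eigenvalues hn i - a) * (hT.eigenvalues hn i - b) *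
        ‖(hT.eigenvectorBasis hn).repr v i‖ ^ 2 := by
  rw [← (hT.eigenvectorBasis hn).repr.inner_map_map, PiLp.inner_apply, Complex.re_sum]
  refine Finset.sum_congr rfl fun i _ => ?_
  have h (c : ℝ) : (hT.eigenvectorBasis hn).repr (T v - (c : ℂ) • v) i =
      ((hT.eigenvalues hn i - c : ℝ) : ℂ) * (hT.eigenvectorBasis hn).repr v i := by
    rw [map_sub, map_smul, PiLp.sub_apply, PiLp.smul_apply, hT.eigenvectorBasis_apply_self_apply]
    push_cast
    simp [sub_mul]
  rw [h, h, RCLike.inner_apply, ← Complex.normSq_eq_norm_sq, Complex.normSq_apply]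
  simp only [map_mul, Complex.conj_ofReal, Complex.mul_re, Complex.mul_im, Complex.ofReal_re,
    Complex.ofReal_im, Complex.conj_re, Complex.conj_im]
  ring

/-- If `0 ≤ S ≤ M` and `λ` is an eigenvalue of `T - S`, then `T` has an eigenvalue in
`[λ, λ + M]`. -/
lemma LinearMap.IsSymmetric.exists_eigenvector_mem_Icc {E : Type*} [NormedAddCommGroup E]
    [InnerProductSpace ℂ E] [FiniteDimensional ℂ E] {S T : E →ₗ[ℂ] E} (hS : S.IsSymmetric)
    (hT : T.IsSymmetric) {M l : ℝ} (hS0 : ∀ x, 0 ≤ (inner ℂ x (S x)).re)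
    (hSM : ∀ x, (inner ℂ x (S x)).re ≤ M * ‖x‖ ^ 2) {v : E} (hv : v ≠ 0)
    (hTv : T v = (l : ℂ) • v + S v) :
    ∃ μ ∈ Set.Icc l (l + M), ∃ w : E, w ≠ 0 ∧ T w = (μ : ℂ) • w := by
  by_contra! hcon
  have hSi (i) : 0 ≤ hS.eigenvalues rfl i ∧ hS.eigenvalues rfl i ≤ M := by
    have h0 := hS0 (hS.eigenvectorBasis rfl i)
    have h1 := hSM (hS.eigenvectorBasis rfl i)
    rw [hS.apply_eigenvectorBasis, inner_smul_right, inner_self_eq_norm_sq_to_K,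
      OrthonormalBasis.norm_eq_one] at h0 h1
    exact ⟨by simpa using h0, by simpa using h1⟩
  have hle := hS.inner_sub_smul_sub_smul rfl 0 M v
  have hpos := hT.inner_sub_smul_sub_smul rfl l (l + M) v
  have heq : (inner ℂ (T v - (l : ℂ) • v) (T v - ((l + M : ℝ) : ℂ) • v)).re =
      (inner ℂ (S v - ((0 : ℝ) : ℂ) • v) (S v - (M : ℂ) • v)).re := by
    congr 2
    · simp [hTv]
    · rw [hTv]
      push_cast
      module
  have hle' : (inner ℂ (S v - ((0 : ℝ) : ℂ) • v) (S v - (M : ℂ) • v)).re ≤ 0 := by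
    rw [hle]
    refine Finset.sum_nonpos fun i _ => mul_nonpos_of_nonpos_of_nonneg ?_ (sq_nonneg _)
    exact mul_nonpos_of_nonneg_of_nonpos (by linarith [hSi i]) (by linarith [hSi i])
  have hTi (i) : 0 < (hT.eigenvalues rfl i - l) * (hT.eigenvalues rfl i - (l + M)) := by
    have hM : 0 ≤ M := (hSi i).1.trans (hSi i).2
    have hmem : hT.eigenvalues rfl i ∉ Set.Icc l (l + M) := fun hi =>
      hcon _ hi _ ((hT.eigenvectorBasis rfl).orthonormal.ne_zero i)
        (hT.apply_eigenvectorBasis rfl i)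
    rcases lt_or_ge (hT.eigenvalues rfl i) l with h | h
    · exact mul_pos_of_neg_of_neg (by linarith) (by linarith)
    · have : l + M < hT.eigenvalues rfl i := lt_of_not_ge fun h' => hmem ⟨h, h'⟩
      exact mul_pos (by linarith) (by linarith)
  obtain ⟨i, hi⟩ : ∃ i, (hT.eigenvectorBasis rfl).repr v i ≠ 0 := by
    by_contra! h
    exact hv ((hT.eigenvectorBasis rfl).repr.map_eq_zero_iff.1 (by ext i; exact h i))
  have : 0 < (inner ℂ (T v - (l : ℂ) • v) (T v - ((l + M : ℝ) : ℂ) • v)).re := by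
    rw [hpos]
    exact Finset.sum_pos' (fun i _ => mul_nonneg (hTi i).le (sq_nonneg _))
      ⟨i, Finset.mem_univ i, mul_pos (hTi i) (pow_pos (norm_pos_iff.2 hi) 2)⟩
  linarith

open Matrix

theorem stmt4 {n : ℕ} (A B : Matrix (Fin n) (Fin n) ℂ)
    (hA : A.IsHermitian) (hB : B.IsHermitian)
    (M : ℝ) (hM : 0 ≤ M)
    (hB0 : ∀ x : Fin n → ℂ, 0 ≤ (star x ⬝ᵥ B.mulVec x).re)
    (hBM : ∀ x : Fin n → ℂ,
      (star x ⬝ᵥ B.mulVec x).re ≤ M * ‖(WithLp.equiv 2 (Fin n → ℂ)).symm x‖ ^ 2)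
    (j : ℕ) (lam : Fin (j + 1) → ℝ) (hmono : StrictMono lam)
    (hgap : ∀ m : Fin j, M < lam m.succ - lam m.castSucc)
    (heig : ∀ m : Fin (j + 1), ∃ v : Fin n → ℂ, v ≠ 0 ∧ A.mulVec v = (lam m : ℂ) • v) :
    ∃ μ : Fin (j + 1) → ℝ, StrictMono μ ∧
      (∀ m : Fin (j + 1), ∃ v : Fin n → ℂ, v ≠ 0 ∧ (A + B).mulVec v = (μ m : ℂ) • v) ∧
      (∀ m : Fin (j + 1), lam m ≤ μ m ∧ μ m ≤ lam m + M) ∧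
      (∀ m : Fin (j + 1), μ m ∈ Set.Icc (lam 0) (lam (Fin.last j) + M)) := by
  have hinner (x : EuclideanSpace ℂ (Fin n)) :
      inner ℂ x (toEuclideanLin B x) = star x.ofLp ⬝ᵥ B.mulVec x.ofLp := by
    rw [EuclideanSpace.inner_eq_star_dotProduct, dotProduct_comm]
    rfl
  have key (m) : ∃ μ ∈ Set.Icc (lam m) (lam m + M),
      ∃ v : Fin n → ℂ, v ≠ 0 ∧ (A + B).mulVec v = (μ : ℂ) • v := by
    obtain ⟨v, hv, hAv⟩ := heig m
    obtain ⟨μ, hμ, w, hw, hTw⟩ := LinearMap.IsSymmetric.exists_eigenvector_mem_Icc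
      (isSymmetric_toEuclideanLin_iff.2 hB) (isSymmetric_toEuclideanLin_iff.2 (hA.add hB))
      (M := M) (l := lam m) (fun x => by rw [hinner]; exact hB0 x.ofLp)
      (fun x => by rw [hinner]; exact hBM x.ofLp) (v := WithLp.toLp 2 v)
      (by simpa using hv) (by ext i; simp [hAv])
    refine ⟨μ, hμ, w.ofLp, by simpa using hw, ?_⟩
    simpa [add_mulVec] using congrArg WithLp.ofLp hTw
  choose μ hμ hev using key
  refine ⟨μ, Fin.strictMono_iff_lt_succ.2 fun i => ?_, hev, hμ, fun m => ⟨?_, ?_⟩⟩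
  · linarith [(hμ i.castSucc).2, (hμ i.succ).1, hgap i]
  · exact (hmono.monotone (Fin.zero_le m)).trans (hμ m).1
  · linarith [(hμ m).2, hmono.monotone (Fin.le_last m)]
end

section
/- Let d ≥ 1 and N ≥ 1 be natural numbers and h = 1/(N+1). Let L be the real matrix indexed by grid points x ∈ (Fin d → Fin N) (the discretized operator −½Δ_h on the d-dimensional unit cube with Dirichlet boundary conditions), with entries L x y = d/h² if x = y; L x y = −1/(2h²) if there exists a coordinate i such that x j = y j for all j ≠ i and |x i − y i| = 1; and L x y = 0 otherwise. For every multi-index k : Fin d → ℕ with 1 ≤ k i ≤ N for all i, the vector u defined by u x = ∏_{i} √(2h) · sin(k i · (x i + 1) · π · h) satisfies L.mulVec u = ((2/h²) · ∑_{i} sin²(k i · π · h / 2)) • u. -/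
open Real

/-- Summing over the points that agree with `x` off coordinate `i` is summing over the values of
that coordinate. -/
theorem sum_ite_eq_off_coordinate {ι α M : Type*} [Fintype ι] [DecidableEq ι] [Fintype α]
    [DecidableEq α] [AddCommMonoid M] (x : ι → α) (i : ι) (G : (ι → α) → M) :
    ∑ y, (if ∀ j, j ≠ i → x j = y j then G y else 0) = ∑ b, G (Function.update x i b) := by
  rw [← Finset.sum_filter]
  have key : ∀ y : ι → α, (∀ j, j ≠ i → x j = y j) → Function.update x i (y i) = y := by
    intro y hy
    ext j
    by_cases hj : j = i
    · subst hj; simp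
    · simp [Function.update_of_ne hj, hy j hj]
  refine Finset.sum_bij' (fun y _ => y i) (fun b _ => Function.update x i b) ?_ ?_ ?_ ?_ ?_
  · simp
  · intro b _
    simp only [Finset.mem_filter, Finset.mem_univ, true_and]
    intro j hj
    simp [Function.update_of_ne hj]
  · intro y hy
    exact key y (by simpa using hy)
  · simp
  · intro y hy
    rw [key y (by simpa using hy)]

/-- The one-dimensional second-difference stencil with step parameter `h`. -/
noncomputable def stencil (h : ℝ) (a b : ℕ) : ℝ :=
  if a = b then 1 / h ^ 2 else if ((a : ℤ) - (b : ℤ)).natAbs = 1 then -1 / (2 * h ^ 2) else 0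

theorem sum_stencil_mul (h : ℝ) {N : ℕ} (a : Fin N) (f : ℕ → ℝ) (h0 : f 0 = 0)
    (hN : f (N + 1) = 0) :
    ∑ b : Fin N, stencil h a b * f (b + 1) =
      1 / h ^ 2 * f (a + 1) - 1 / (2 * h ^ 2) * (f a + f (a + 2)) := by
  obtain ⟨a, ha⟩ := a
  rw [Fin.sum_univ_eq_sum_range (fun b => stencil h a b * f (b + 1)) N]
  have hsplit : ∀ b, stencil h a b * f (b + 1) =
      (if a = b then 1 / h ^ 2 * f (b + 1) else 0) -
        ((if a = b + 1 then 1 / (2 * h ^ 2) * f (b + 1) else 0) +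
          (if a + 1 = b then 1 / (2 * h ^ 2) * f (b + 1) else 0)) := by
    intro b
    unfold stencil
    split_ifs <;> first | omega | ring
  have hlow : ∑ b ∈ Finset.range N, (if a = b + 1 then 1 / (2 * h ^ 2) * f (b + 1) else 0) =
      1 / (2 * h ^ 2) * f a := by
    cases a with
    | zero => simp [h0]
    | succ a =>
      simp only [Nat.add_right_cancel_iff]
      rw [Finset.sum_ite_eq, if_pos (Finset.mem_range.2 (by omega))]
  have hhigh : ∑ b ∈ Finset.range N, (if a + 1 = b then 1 / (2 * h ^ 2) * f (b + 1) else 0) =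
      1 / (2 * h ^ 2) * f (a + 2) := by
    rw [Finset.sum_ite_eq]
    split_ifs with hm
    · rfl
    · have : a + 2 = N + 1 := by
        rw [Finset.mem_range] at hm
        omega
      rw [this, hN, mul_zero]
  simp only [hsplit, Finset.sum_sub_distrib, Finset.sum_add_distrib, hlow, hhigh]
  rw [Finset.sum_ite_eq, if_pos (Finset.mem_range.2 ha)]
  ring

theorem sum_stencil_mul_sin (h : ℝ) {N : ℕ} (hh : h = 1 / (N + 1)) (k : ℕ) (a : Fin N) :
    ∑ b : Fin N, stencil h a b * (√(2 * h) * sin (k * ((b : ℕ) + 1) * π * h)) =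
      2 / h ^ 2 * sin (k * π * h / 2) ^ 2 * (√(2 * h) * sin (k * ((a : ℕ) + 1) * π * h)) := by
  have hend : (k : ℝ) * ((N + 1 : ℕ) : ℝ) * π * h = k * π := by
    have : (N : ℝ) + 1 ≠ 0 := by positivity
    rw [hh]
    push_cast
    field_simp
  have main := sum_stencil_mul h a (fun m => √(2 * h) * sin (k * (m : ℝ) * π * h)) (by simp)
    (by simp only [hend, sin_nat_mul_pi, mul_zero])
  push_cast at main
  rw [main]
  set t : ℝ := k * π * h / 2 with ht
  have e0 : (k : ℝ) * ((a : ℕ) : ℝ) * π * h = k * (((a : ℕ) : ℝ) + 1) * π * h - 2 * t := by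
    rw [ht]; ring
  have e2 : (k : ℝ) * (((a : ℕ) : ℝ) + 2) * π * h = k * (((a : ℕ) : ℝ) + 1) * π * h + 2 * t := by
    rw [ht]; ring
  rw [e0, e2, sin_sub, sin_add, cos_two_mul, cos_sq']
  ring

theorem stmt8 (d N : ℕ) (hd : 1 ≤ d) (hN : 1 ≤ N) (h : ℝ) (hh : h = 1 / (N + 1))
    (L : Matrix (Fin d → Fin N) (Fin d → Fin N) ℝ)
    (hdiag : ∀ x, L x x = d / h ^ 2)
    (hoff : ∀ x y : Fin d → Fin N,
      (∃ i, (∀ j, j ≠ i → x j = y j) ∧ (((x i : ℕ) : ℤ) - ((y i : ℕ) : ℤ)).natAbs = 1) →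
        L x y = -1 / (2 * h ^ 2))
    (hzero : ∀ x y : Fin d → Fin N, x ≠ y →
      ¬(∃ i, (∀ j, j ≠ i → x j = y j) ∧ (((x i : ℕ) : ℤ) - ((y i : ℕ) : ℤ)).natAbs = 1) →
        L x y = 0)
    (k : Fin d → ℕ) (hk : ∀ i, 1 ≤ k i ∧ k i ≤ N)
    (u : (Fin d → Fin N) → ℝ)
    (hu : ∀ x, u x = ∏ i, Real.sqrt (2 * h) * Real.sin (k i * ((x i : ℕ) + 1) * π * h)) :
    L.mulVec u = ((2 / h ^ 2) * ∑ i, Real.sin (k i * π * h / 2) ^ 2) • u := by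
  have hL : ∀ x y, L x y =
      ∑ i, if ∀ j, j ≠ i → x j = y j then stencil h (x i) (y i) else 0 := by
    intro x y
    by_cases hxy : x = y
    · subst hxy
      simp [hdiag, stencil, div_eq_mul_inv]
    by_cases hex : ∃ i, (∀ j, j ≠ i → x j = y j) ∧
        (((x i : ℕ) : ℤ) - ((y i : ℕ) : ℤ)).natAbs = 1
    · rw [hoff x y hex]
      obtain ⟨i, hi, hi1⟩ := hex
      have hne : (x i : ℕ) ≠ (y i : ℕ) := by omega
      rw [Finset.sum_eq_single i, if_pos hi, stencil, if_neg hne, if_pos hi1]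
      · intro j _ hji
        refine if_neg fun hj => hne ?_
        rw [hj i hji.symm]
      · simp
    · rw [hzero x y hxy hex]
      refine (Finset.sum_eq_zero fun i _ => ?_).symm
      split_ifs with hi
      · have hne : (x i : ℕ) ≠ (y i : ℕ) := by
          intro he
          refine hxy (funext fun j => ?_)
          by_cases hj : j = i
          · subst hj
            exact Fin.ext he
          · exact hi j hj
        rw [stencil, if_neg hne, if_neg fun h1 => hex ⟨i, hi, h1⟩]
      · rfl
  have hupd : ∀ x i b, u (Function.update x i b) =
      (√(2 * h) * sin (k i * ((b : ℕ) + 1) * π * h)) *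
        ∏ j ∈ Finset.univ.erase i, √(2 * h) * sin (k j * ((x j : ℕ) + 1) * π * h) := by
    intro x i b
    rw [hu, ← Finset.mul_prod_erase _ _ (Finset.mem_univ i), Function.update_self]
    congr 1
    refine Finset.prod_congr rfl fun j hj => ?_
    rw [Function.update_of_ne (Finset.ne_of_mem_erase hj)]
  ext x
  have hrow : ∀ i, ∑ y, (if ∀ j, j ≠ i → x j = y j then stencil h (x i) (y i) else 0) * u y =
      2 / h ^ 2 * sin (k i * π * h / 2) ^ 2 * u x := by
    intro i
    simp only [ite_mul, zero_mul]
    have hsum := sum_ite_eq_off_coordinate x i fun y => stencil h (x i) (y i) * u y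
    refine Eq.trans (Eq.trans ?_ hsum) ?_
    · congr!
    simp only [hupd, Function.update_self]
    rw [Finset.sum_congr rfl fun b _ => (mul_assoc _ _ _).symm, ← Finset.sum_mul, sum_stencil_mul_sin h hh, mul_assoc, ← hupd, Function.update_eq_self]
  simp only [Matrix.mulVec, dotProduct, hL, Finset.sum_mul, Pi.smul_apply, smul_eq_mul,
    Finset.mul_sum]
  rw [Finset.sum_comm]
  exact Finset.sum_congr rfl fun i _ => hrow i
end

section
/- Let d ≥ 1 and let C be a natural number, and set m₀ = ⌊C/3⌋ (natural division). Then the set S = {k : Fin d → ℕ | (∀ i, k i ≥ 1) ∧ ∑_{i} (k i)² ≤ d + C} is finite, and its cardinality is at most (m₀ + 1) · (d · (C + 1))^{m₀}. In particular, for fixed C the cardinality of S is bounded by a polynomial in d. -/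
/-- The functions `ι → ℕ` with sum at most `m` are covered by a finset of at most
`(card ι + 1) ^ m` functions: each is a sum of `m` terms that are zero or a unit vector. -/
theorem exists_finset_card_le_of_sum_le {ι : Type*} [Fintype ι] [DecidableEq ι] (m : ℕ) :
    ∃ F : Finset (ι → ℕ), F.card ≤ (Fintype.card ι + 1) ^ m ∧
      ∀ j : ι → ℕ, ∑ i, j i ≤ m → j ∈ F := by
  induction m with
  | zero =>
    refine ⟨{0}, by simp, fun j hj => ?_⟩
    simpa [funext_iff] using hj
  | succ m ih =>
    obtain ⟨F, hF, hmem⟩ := ih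
    refine ⟨(F ×ˢ (Finset.univ : Finset (Option ι))).image
      (fun p => p.1 + p.2.elim 0 (fun i => Pi.single i 1)), ?_, fun j hj => ?_⟩
    · refine Finset.card_image_le.trans ?_
      rw [Finset.card_product, Finset.card_univ, Fintype.card_option, pow_succ]
      gcongr
    · rw [Finset.mem_image]
      by_cases h : ∃ i, j i ≠ 0
      · obtain ⟨i, hi⟩ := h
        have hle : Pi.single i 1 ≤ j := by
          intro a
          rcases eq_or_ne a i with rfl | ha
          · simpa using Nat.one_le_iff_ne_zero.mpr hi
          · simp [ha]
        have hj' : j - Pi.single i 1 + Pi.single i 1 = j := tsub_add_cancel_of_le hle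
        refine ⟨(j - Pi.single i 1, some i), ?_, hj'⟩
        have hs : ∑ a, (j - Pi.single i 1 : ι → ℕ) a + 1 = ∑ a, j a := by
          conv_rhs => rw [← hj']
          simp only [Pi.add_apply, Finset.sum_add_distrib, Finset.sum_pi_single', Finset.mem_univ,
            if_true]
        simpa using hmem _ (by omega)
      · push Not at h
        exact ⟨(j, none), by simpa using hmem j (by simp [h]), by simp⟩

/-- If all `k i` are positive, then `3 * (k i - 1) ≤ (k i) ^ 2 - 1` bounds the total excess. -/
theorem sum_sub_one_le_div_three {d C : ℕ} {k : Fin d → ℕ} (hk : ∀ i, 1 ≤ k i)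
    (hs : ∑ i, (k i) ^ 2 ≤ d + C) : ∑ i, (k i - 1) ≤ C / 3 := by
  have h : ∑ i, (3 * (k i - 1) + 1) ≤ ∑ i, (k i) ^ 2 := by
    refine Finset.sum_le_sum fun i _ => ?_
    obtain ⟨a, ha⟩ := Nat.exists_eq_add_of_le (hk i)
    have : a ≤ a ^ 2 := Nat.le_self_pow two_ne_zero a
    rw [ha, Nat.add_sub_cancel_left]
    nlinarith
  rw [Finset.sum_add_distrib, ← Finset.mul_sum] at h
  simp only [Finset.sum_const, Finset.card_univ, Fintype.card_fin, smul_eq_mul, mul_one] at h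
  omega

theorem stmt12 (d : ℕ) (hd : 1 ≤ d) (C : ℕ) :
    {k : Fin d → ℕ | (∀ i, 1 ≤ k i) ∧ ∑ i, (k i) ^ 2 ≤ d + C}.Finite ∧
      {k : Fin d → ℕ | (∀ i, 1 ≤ k i) ∧ ∑ i, (k i) ^ 2 ≤ d + C}.ncard
        ≤ (C / 3 + 1) * (d * (C + 1)) ^ (C / 3) := by
  obtain ⟨F, hF, hmem⟩ := exists_finset_card_le_of_sum_le (ι := Fin d) (C / 3)
  rw [Fintype.card_fin] at hF
  have hsub : {k : Fin d → ℕ | (∀ i, 1 ≤ k i) ∧ ∑ i, (k i) ^ 2 ≤ d + C} ⊆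
      (F.image (fun j => j + 1) : Finset (Fin d → ℕ)) := by
    rintro k ⟨hk, hs⟩
    rw [Finset.mem_coe, Finset.mem_image]
    exact ⟨fun i => k i - 1, hmem _ (sum_sub_one_le_div_three hk hs),
      funext fun i => Nat.sub_add_cancel (hk i)⟩
  refine ⟨(Finset.finite_toSet _).subset hsub, ?_⟩
  have hpow : (d + 1) ^ (C / 3) ≤ (d * (C + 1)) ^ (C / 3) := by
    rcases Nat.eq_zero_or_pos (C / 3) with h | h
    · simp [h]
    · have : 3 ≤ C := by omega
      exact Nat.pow_le_pow_left (by nlinarith) _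
  calc _ ≤ (F.image (fun j => j + 1)).card := by
        simpa only [Set.ncard_coe_finset] using Set.ncard_le_ncard hsub (Finset.finite_toSet _)
    _ ≤ (d * (C + 1)) ^ (C / 3) := Finset.card_image_le.trans (hF.trans hpow)
    _ ≤ _ := Nat.le_mul_of_pos_left _ (Nat.succ_pos _)
end
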